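/- arXiv:2302.13790 — 4 statements merged into one kernel-verified Lean document; each statement's English description precedes it below -/
import Mathlib

section
/- Let f : Y → X be a quasi-compact morphism of schemes that is surjective on underlying topological spaces. Then f is surjective on closed points: for every closed point x of X there exists a closed point y of Y with f(y) = x. -/
open AlgebraicGeometry

/-- A quasi-compact morphism of schemes that is surjective on underlying
topological spaces is surjective on closed points. -/
theorem quasiCompact_surjective_on_closed_points
    {X Y : AlgebraicGeometry.Scheme} (f : Y ⟶ X) [QuasiCompact f]
    (hf : Function.Surjective f.base) :
    ∀ x : X, IsClosed ({x} : Set X) →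
      ∃ y : Y, IsClosed ({y} : Set Y) ∧ f.base y = x := by
  intro x hx
  obtain ⟨U, hU, hxU, -⟩ := exists_isAffineOpen_mem_and_subset (U := ⊤) (x := x) trivial
  have hK : IsClosed (f ⁻¹' {x}) := hx.preimage f.continuous
  have hc : IsCompact (f ⁻¹' {x}) :=
    (f.isCompact_preimage hU.isCompact).of_isClosed_subset hK (by
      intro y hy
      have : f y = x := hy
      show f y ∈ U
      rw [this]; exact hxU)
  have : CompactSpace (f ⁻¹' {x}) := isCompact_iff_compactSpace.mp hc
  obtain ⟨y₀, hy₀⟩ := hf x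
  obtain ⟨y, -, hy⟩ := (isClosed_univ (X := (f ⁻¹' {x} : Set Y))).exists_closed_singleton
    ⟨⟨y₀, hy₀⟩, trivial⟩
  refine ⟨y.1, ?_, y.2⟩
  have := hK.isClosedMap_subtype_val _ hy
  simpa using this
end

section
/- Let k be a field and let f : Y → X be a surjective morphism of schemes of finite type over k. Let pr_1, pr_2 : Y ×_X Y → Y be the two projections of the fibre product. Then the sequence Z_0(Y ×_X Y) → Z_0(Y) → Z_0(X) → 0 is exact, where the first map is pr_{1*} − pr_{2*} and the second map is f_*; that is, f_* is surjective and the kernel of f_* equals the image of pr_{1*} − pr_{2*}. -/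
open AlgebraicGeometry CategoryTheory CategoryTheory.Limits Finsupp

/-- Let `k` be a field and `f : Y ⟶ X` a surjective morphism of schemes of
finite type over `k`, and let `pr₁, pr₂ : Y ×_X Y ⟶ Y` be the two projections of the fibre
product.  Realizing the space `Z₀` of `0`-cycles with rational coefficients on a scheme as the
subspace of finitely supported `ℚ`-valued functions supported on the closed points, the sequence
`Z₀(Y ×_X Y) → Z₀(Y) → Z₀(X) → 0`, with first map `pr₁₊ - pr₂₊` and second map `f₊`
(pushforward = `Finsupp.mapDomain`), is exact: `f₊ : Z₀(Y) → Z₀(X)` is surjective, and an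
element of `Z₀(Y)` is killed by `f₊` if and only if it is of the form `pr₁₊ ξ - pr₂₊ ξ` for
some `ξ ∈ Z₀(Y ×_X Y)`. -/
theorem zero_cycles_right_exact_sequence
    {k : Type*} [Field k] {X Y : AlgebraicGeometry.Scheme}
    (sX : X ⟶ Spec (CommRingCat.of k)) (sY : Y ⟶ Spec (CommRingCat.of k))
    [LocallyOfFiniteType sX] [QuasiCompact sX]
    [LocallyOfFiniteType sY] [QuasiCompact sY]
    (f : Y ⟶ X) (hf : f ≫ sX = sY) (hsurj : Function.Surjective f.base) :
    -- the two pushforwards map `0`-cycles to `0`-cycles: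
    (∀ φ : Y →₀ ℚ, (∀ q ∈ φ.support, IsClosed ({q} : Set Y)) →
        ∀ x ∈ (Finsupp.mapDomain f.base φ).support, IsClosed ({x} : Set X)) ∧
    (∀ ξ : ↑(pullback f f) →₀ ℚ,
        (∀ w ∈ ξ.support, IsClosed ({w} : Set ↑(pullback f f))) →
        ∀ q ∈ (Finsupp.mapDomain (pullback.fst f f).base ξ
                - Finsupp.mapDomain (pullback.snd f f).base ξ).support,
          IsClosed ({q} : Set Y)) ∧
    -- surjectivity of `f₊ : Z₀(Y) → Z₀(X)`:
    (∀ ψ : X →₀ ℚ, (∀ x ∈ ψ.support, IsClosed ({x} : Set X)) →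
        ∃ φ : Y →₀ ℚ, (∀ q ∈ φ.support, IsClosed ({q} : Set Y)) ∧
          Finsupp.mapDomain f.base φ = ψ) ∧
    -- exactness at `Z₀(Y)`: the kernel of `f₊` is the image of `pr₁₊ - pr₂₊`:
    (∀ φ : Y →₀ ℚ, (∀ q ∈ φ.support, IsClosed ({q} : Set Y)) →
        (Finsupp.mapDomain f.base φ = 0 ↔
          ∃ ξ : ↑(pullback f f) →₀ ℚ,
            (∀ w ∈ ξ.support, IsClosed ({w} : Set ↑(pullback f f))) ∧
            Finsupp.mapDomain (pullback.fst f f).base ξ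
              - Finsupp.mapDomain (pullback.snd f f).base ξ = φ)) := by
  classical
  subst hf
  have hJX : JacobsonSpace X := LocallyOfFiniteType.jacobsonSpace (Y := Spec _) sX
  have hJY : JacobsonSpace Y := LocallyOfFiniteType.jacobsonSpace (Y := Spec _) (f ≫ sX)
  have hft : LocallyOfFiniteType f := locallyOfFiniteType_of_comp f sX
  have hJP : JacobsonSpace ↑(pullback f f) :=
    LocallyOfFiniteType.jacobsonSpace (pullback.fst f f)
  have push : ∀ {A B : Scheme} (g : A ⟶ B) [JacobsonSpace B] [LocallyOfFiniteType g]
      (φ : A →₀ ℚ), (∀ q ∈ φ.support, IsClosed ({q} : Set A)) →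
      ∀ x ∈ (Finsupp.mapDomain g.base φ).support, IsClosed ({x} : Set B) := by
    intro A B g _ _ φ hφ x hx
    obtain ⟨q, hq, rfl⟩ := Finset.mem_image.mp (Finsupp.mapDomain_support hx)
    exact g.closePoints_subset_preimage_closedPoints (hφ q hq)
  have hs : ∀ x : X, ∃ y : Y, f.base y = x ∧ (IsClosed ({x} : Set X) → IsClosed ({y} : Set Y)) := by
    intro x
    by_cases hx : IsClosed ({x} : Set X)
    · obtain ⟨y, hy, hyc⟩ := nonempty_inter_closedPoints (Z := f.base ⁻¹' {x})
        (hsurj x) (hx.preimage f.continuous).isLocallyClosed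
      exact ⟨y, hy, fun _ => hyc⟩
    · obtain ⟨y, hy⟩ := hsurj x
      exact ⟨y, hy, fun h => absurd h hx⟩
  choose s hs1 hs2 using hs
  have hw : ∀ q : Y, ∃ w : ↑(pullback f f), IsClosed ({q} : Set Y) →
      (pullback.fst f f).base w = q ∧ (pullback.snd f f).base w = s (f.base q) ∧
      IsClosed ({w} : Set ↑(pullback f f)) := by
    intro q
    obtain ⟨z, hz1, hz2⟩ := Scheme.Pullback.exists_preimage_pullback (f := f) (g := f)
      q (s (f.base q)) (hs1 (f.base q)).symm
    by_cases hq : IsClosed ({q} : Set Y)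
    · have hq2 : IsClosed ({s (f.base q)} : Set Y) :=
        hs2 _ (f.closePoints_subset_preimage_closedPoints hq)
      obtain ⟨w, ⟨h1, h2⟩, hwc⟩ := nonempty_inter_closedPoints
        (Z := (pullback.fst f f).base ⁻¹' {q} ∩ (pullback.snd f f).base ⁻¹' {s (f.base q)})
        ⟨z, hz1, hz2⟩
        ((hq.preimage (pullback.fst f f).continuous).inter
          (hq2.preimage (pullback.snd f f).continuous)).isLocallyClosed
      exact ⟨w, fun _ => ⟨h1, h2, hwc⟩⟩
    · exact ⟨z, fun h => absurd h hq⟩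
  choose w hw using hw
  refine ⟨fun φ hφ => push f φ hφ, ?_, ?_, ?_⟩
  · intro ξ hξ q hq
    rcases Finset.mem_union.mp (Finsupp.support_sub hq) with h | h
    · exact push _ ξ hξ q h
    · exact push _ ξ hξ q h
  · intro ψ hψ
    refine ⟨Finsupp.mapDomain s ψ, ?_, ?_⟩
    · intro q hq
      obtain ⟨x, hx, rfl⟩ := Finset.mem_image.mp (Finsupp.mapDomain_support hq)
      exact hs2 x (hψ x hx)
    · rw [← Finsupp.mapDomain_comp]
      have : (f.base ∘ s : X → X) = id := funext hs1
      exact (congrArg (fun g => Finsupp.mapDomain g ψ) this).trans Finsupp.mapDomain_id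
  · intro φ hφ
    constructor
    · intro h0
      refine ⟨Finsupp.mapDomain w φ, ?_, ?_⟩
      · intro z hz
        obtain ⟨q, hq, rfl⟩ := Finset.mem_image.mp (Finsupp.mapDomain_support hz)
        exact (hw q (hφ q hq)).2.2
      · have e1 : Finsupp.mapDomain (pullback.fst f f).base (Finsupp.mapDomain w φ) = φ := by
          rw [← Finsupp.mapDomain_comp]
          exact (Finsupp.mapDomain_congr (g := id) fun q hq => (hw q (hφ q hq)).1).trans
            Finsupp.mapDomain_id
        have e2 : Finsupp.mapDomain (pullback.snd f f).base (Finsupp.mapDomain w φ) = 0 := by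
          rw [← Finsupp.mapDomain_comp]
          refine (Finsupp.mapDomain_congr (g := s ∘ f.base)
            fun q hq => (hw q (hφ q hq)).2.1).trans ?_
          rw [Finsupp.mapDomain_comp, h0, Finsupp.mapDomain_zero]
        rw [e1, e2, sub_zero]
    · rintro ⟨ξ, -, rfl⟩
      have hc : (f.base ∘ (pullback.fst f f).base : ↑(pullback f f) → X)
          = f.base ∘ (pullback.snd f f).base := by
        funext z
        have := congrArg (fun g : pullback f f ⟶ X => g.base z) (pullback.condition (f := f) (g := f))
        simpa using this
      have : Finsupp.mapDomain f.base (Finsupp.mapDomain (pullback.fst f f).base ξ)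
          = Finsupp.mapDomain f.base (Finsupp.mapDomain (pullback.snd f f).base ξ) := by
        rw [← Finsupp.mapDomain_comp, ← Finsupp.mapDomain_comp]
        exact congrArg (fun g => Finsupp.mapDomain g ξ) hc
      have hsub := map_sub (Finsupp.mapDomain.addMonoidHom (M := ℚ) f.base)
        (Finsupp.mapDomain (pullback.fst f f).base ξ) (Finsupp.mapDomain (pullback.snd f f).base ξ)
      exact hsub.trans (sub_eq_zero.mpr this)
end

section
/- Let k be a field, n ≥ 1, and let H ⊂ ℙⁿ_k be the hyperplane defined by W₀ = 0 in homogeneous coordinates (W₀ : … : Wₙ). Let N ≥ 2 and let p₁, p₂, …, p_N be closed points of ℙⁿ_k such that p₂, …, p_N lie on H and p₁ does not lie on H. Then there exists a finite morphism ψ : ℙⁿ_k → ℙⁿ_k of k-schemes and two distinct k-rational points p, q of ℙⁿ_k such that ψ(p_i) = p for all 2 ≤ i ≤ N and ψ(p₁) = q. -/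
open AlgebraicGeometry CategoryTheory MvPolynomial

namespace ScaledProj
open HomogeneousLocalization

universe u
variable {A : Type u} [CommRing A] {σ : Type*} [SetLike σ A] [AddSubgroupClass σ A]
  (𝒜 : ℕ → σ) [GradedRing 𝒜] (φ : A →+* A) (D : ℕ)
  (hφ : ∀ m a, a ∈ 𝒜 m → φ a ∈ 𝒜 (D * m))

/-- The map induced by `φ` on localizations. -/
noncomputable def locMap (s : A) : Localization.Away s →+* Localization.Away (φ s) :=
  IsLocalization.map (M := Submonoid.powers s) (T := Submonoid.powers (φ s)) _ φ
    (by rw [← Submonoid.map_le_iff_le_comap, Submonoid.map_powers])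

lemma locMap_mk (s a : A) (b : Submonoid.powers s) (c : Submonoid.powers (φ s))
    (h : (c : A) = φ b) :
    locMap φ s (Localization.mk a b) = Localization.mk (φ a) c := by
  rw [Localization.mk_eq_mk', locMap, IsLocalization.map_mk', Localization.mk_eq_mk']
  congr 1
  ext; exact h.symm

lemma exists_val (hφ : ∀ m a, a ∈ 𝒜 m → φ a ∈ 𝒜 (D * m)) (s : A) (x : Away 𝒜 s) :
    ∃ y : Away 𝒜 (φ s), y.val = locMap φ s x.val := by
  obtain ⟨⟨n, ⟨a, ha⟩, ⟨b, hb⟩, hb'⟩, rfl⟩ := mk_surjective x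
  have hb3 : b ∈ Submonoid.powers s := hb'
  obtain ⟨i, hi⟩ := hb3
  have hb2 : φ b ∈ Submonoid.powers (φ s) := ⟨i, by simp [← hi]⟩
  refine ⟨HomogeneousLocalization.mk ⟨D * n, ⟨φ a, hφ _ _ ha⟩, ⟨φ b, hφ _ _ hb⟩, hb2⟩, ?_⟩
  rw [val_mk, val_mk]
  exact (locMap_mk φ s a ⟨b, hb'⟩ ⟨φ b, hb2⟩ rfl).symm

/-- The map induced by `φ` on homogeneous localizations. -/
noncomputable def awayHom (s : A) : Away 𝒜 s →+* Away 𝒜 (φ s) where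
  toFun x := (exists_val 𝒜 φ D hφ s x).choose
  map_one' := val_injective _ <| by rw [(exists_val 𝒜 φ D hφ s _).choose_spec]; simp
  map_zero' := val_injective _ <| by rw [(exists_val 𝒜 φ D hφ s _).choose_spec]; simp
  map_add' x y := val_injective _ <| by
    rw [(exists_val 𝒜 φ D hφ s _).choose_spec, val_add, val_add,
      (exists_val 𝒜 φ D hφ s _).choose_spec, (exists_val 𝒜 φ D hφ s _).choose_spec, map_add]
  map_mul' x y := val_injective _ <| by
    rw [(exists_val 𝒜 φ D hφ s _).choose_spec, val_mul, val_mul,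
      (exists_val 𝒜 φ D hφ s _).choose_spec, (exists_val 𝒜 φ D hφ s _).choose_spec, map_mul]

lemma val_awayHom (s : A) (x : Away 𝒜 s) :
    (awayHom 𝒜 φ D hφ s x).val = locMap φ s x.val :=
  (exists_val 𝒜 φ D hφ s x).choose_spec

lemma awayHom_awayMap {f g x : A} {m m' : ℕ} (hg : g ∈ 𝒜 m) (hx : x = f * g)
    (hg' : φ g ∈ 𝒜 m') (hx' : φ x = φ f * φ g) :
    (awayHom 𝒜 φ D hφ x).comp (awayMap 𝒜 hg hx) =
      (awayMap 𝒜 hg' hx').comp (awayHom 𝒜 φ D hφ f) := by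
  refine RingHom.ext fun a ↦ val_injective _ ?_
  simp only [RingHom.comp_apply, val_awayHom, val_awayMap]
  simp only [← RingHom.comp_apply]
  congr 1
  apply IsLocalization.ringHom_ext (M := .powers f)
  ext i
  simp [Localization.awayLift, locMap]

lemma awayHom_fromZero (h0 : ∀ a ∈ 𝒜 0, φ a = a) (s : A) :
    (awayHom 𝒜 φ D hφ s).comp (fromZeroRingHom 𝒜 _) = fromZeroRingHom 𝒜 _ := by
  refine RingHom.ext fun a ↦ val_injective _ ?_
  simp only [RingHom.comp_apply, val_awayHom]
  change locMap φ s (Localization.mk a.1 1) = Localization.mk a.1 1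
  rw [locMap_mk φ s _ 1 1 (by simp), h0 _ a.2]

variable {ι : Type*} (s : ι → A) (m : ι → ℕ) (hs : ∀ i, s i ∈ 𝒜 (m i)) (hm : ∀ i, 0 < m i)
  (hD : 0 < D)
  (hcov : ∀ x : Proj 𝒜, ∃ i, φ (s i) ∉ x.asHomogeneousIdeal)

/-- cover by the `D₊(φ sᵢ)` -/
noncomputable def cov : (Proj 𝒜).AffineOpenCover where
  I₀ := ι
  X i := .of (Away 𝒜 (φ (s i)))
  f i := Proj.awayι 𝒜 (φ (s i)) (hφ _ _ (hs i)) (Nat.mul_pos hD (hm i))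
  idx x := (hcov x).choose
  covers x := by
    change x ∈ (Proj.awayι 𝒜 _ _ _).opensRange
    rw [Proj.opensRange_awayι]
    exact (hcov x).choose_spec

lemma glue_aux {f g : A} {a b : ℕ} (hf : f ∈ 𝒜 a) (hg : g ∈ 𝒜 b) (ha : 0 < a) (hb : 0 < b) :
    Spec.map (CommRingCat.ofHom (awayMap 𝒜 (hφ _ _ hg) (map_mul φ f g))) ≫ 
      Spec.map (CommRingCat.ofHom (awayHom 𝒜 φ D hφ f)) ≫ Proj.awayι 𝒜 f hf ha = 
    Spec.map (CommRingCat.ofHom (awayHom 𝒜 φ D hφ (f * g))) ≫ 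
      Proj.awayι 𝒜 (f * g) (SetLike.mul_mem_graded hf hg) (by omega) := by
  rw [← Proj.SpecMap_awayMap_awayι 𝒜 hf ha hg rfl, ← Spec.map_comp_assoc, ← Spec.map_comp_assoc,
    ← CommRingCat.ofHom_comp, ← CommRingCat.ofHom_comp]
  rw [awayHom_awayMap 𝒜 φ D hφ hg rfl (hφ _ _ hg) (map_mul φ f g)]

lemma glue_compat (i j : ι) :
    Limits.pullback.fst (Proj.awayι 𝒜 (φ (s i)) (hφ _ _ (hs i)) (Nat.mul_pos hD (hm i)))
       (Proj.awayι 𝒜 (φ (s j)) (hφ _ _ (hs j)) (Nat.mul_pos hD (hm j))) ≫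
      Spec.map (CommRingCat.ofHom (awayHom 𝒜 φ D hφ (s i))) ≫
        Proj.awayι 𝒜 (s i) (hs i) (hm i) =
      Limits.pullback.snd (Proj.awayι 𝒜 (φ (s i)) (hφ _ _ (hs i)) (Nat.mul_pos hD (hm i)))
       (Proj.awayι 𝒜 (φ (s j)) (hφ _ _ (hs j)) (Nat.mul_pos hD (hm j))) ≫
      Spec.map (CommRingCat.ofHom (awayHom 𝒜 φ D hφ (s j))) ≫
        Proj.awayι 𝒜 (s j) (hs j) (hm j) := by
    rw [← cancel_epi (Proj.pullbackAwayιIso 𝒜 (hφ _ _ (hs i)) (Nat.mul_pos hD (hm i))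
      (hφ _ _ (hs j)) (Nat.mul_pos hD (hm j)) (map_mul φ (s i) (s j))).inv,
      Proj.pullbackAwayιIso_inv_fst_assoc, Proj.pullbackAwayιIso_inv_snd_assoc,
      glue_aux 𝒜 φ D hφ (hs i) (hs j) (hm i) (hm j)]
    have := glue_aux 𝒜 φ D hφ (hs j) (hs i) (hm j) (hm i)
    have key : ∀ (x : A) (hx : x = s j * s i) (hd : x ∈ 𝒜 (m i + m j)) (h1 : φ x = φ (s j) * φ (s i)),
      Spec.map (CommRingCat.ofHom (awayHom 𝒜 φ D hφ x)) ≫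
        Proj.awayι 𝒜 x hd (by have := hm i; omega) =
      Spec.map (CommRingCat.ofHom (awayMap 𝒜 (hφ _ _ (hs i)) h1)) ≫ 
      Spec.map (CommRingCat.ofHom (awayHom 𝒜 φ D hφ (s j))) ≫ 
        Proj.awayι 𝒜 (s j) (hs j) (hm j) := by
      rintro x rfl hd h1
      rw [this]
      have irr : ∀ (a b : ℕ) (x : A) (ha : x ∈ 𝒜 a) (hb : x ∈ 𝒜 b) (ha0 : 0 < a) (hb0 : 0 < b),
          a = b → Proj.awayι 𝒜 x ha ha0 = Proj.awayι 𝒜 x hb hb0 := by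
        rintro a b x ha hb ha0 hb0 rfl; rfl
      rw [irr _ _ _ hd _ _ _ (add_comm _ _)]
    exact key _ (mul_comm _ _) _ _

/-- The glued morphism. -/
noncomputable def psi : Proj 𝒜 ⟶ Proj 𝒜 :=
  (cov 𝒜 φ D hφ s m hs hm hD hcov).openCover.glueMorphisms
    (fun i => Spec.map (CommRingCat.ofHom (awayHom 𝒜 φ D hφ (s i))) ≫
      Proj.awayι 𝒜 (s i) (hs i) (hm i))
    (fun i j => glue_compat 𝒜 φ D hφ s m hs hm hD i j)

lemma awayι_psi (i : ι) :
    Proj.awayι 𝒜 (φ (s i)) (hφ _ _ (hs i)) (Nat.mul_pos hD (hm i)) ≫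
      psi 𝒜 φ D hφ s m hs hm hD hcov =
    Spec.map (CommRingCat.ofHom (awayHom 𝒜 φ D hφ (s i))) ≫
      Proj.awayι 𝒜 (s i) (hs i) (hm i) :=
  (cov 𝒜 φ D hφ s m hs hm hD hcov).openCover.ι_glueMorphisms _ _ i

lemma psi_toSpecZero (h0 : ∀ a ∈ 𝒜 0, φ a = a) :
    psi 𝒜 φ D hφ s m hs hm hD hcov ≫ Proj.toSpecZero 𝒜 = Proj.toSpecZero 𝒜 := by
  refine (cov 𝒜 φ D hφ s m hs hm hD hcov).openCover.hom_ext _ _ fun i ↦ ?_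
  have key : ∀ i : ι, Proj.awayι 𝒜 (φ (s i)) (hφ _ _ (hs i)) (Nat.mul_pos hD (hm i)) ≫
      psi 𝒜 φ D hφ s m hs hm hD hcov ≫ Proj.toSpecZero 𝒜 =
    Proj.awayι 𝒜 (φ (s i)) (hφ _ _ (hs i)) (Nat.mul_pos hD (hm i)) ≫ Proj.toSpecZero 𝒜 := by
   intro i
   rw [← Category.assoc, awayι_psi, Category.assoc, Proj.awayι_toSpecZero, Proj.awayι_toSpecZero,
    ← Spec.map_comp, ← CommRingCat.ofHom_comp, awayHom_fromZero 𝒜 φ D hφ h0]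
  exact key i

lemma psi_mem {g : A} {e : ℕ} (hg : g ∈ 𝒜 e) (he : 0 < e) (x : Proj 𝒜) :
    g ∈ (psi 𝒜 φ D hφ s m hs hm hD hcov x).asHomogeneousIdeal ↔
      φ g ∈ x.asHomogeneousIdeal := by
  obtain ⟨i, hi⟩ := hcov x
  have hx : x ∈ (Proj.awayι 𝒜 (φ (s i)) (hφ _ _ (hs i)) (Nat.mul_pos hD (hm i))).opensRange := by
    rw [Proj.opensRange_awayι]; exact hi
  obtain ⟨z, rfl⟩ := hx
  rw [← not_iff_not]
  have e1 : psi 𝒜 φ D hφ s m hs hm hD hcov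
      (Proj.awayι 𝒜 (φ (s i)) (hφ _ _ (hs i)) (Nat.mul_pos hD (hm i)) z) =
      Proj.awayι 𝒜 (s i) (hs i) (hm i)
        (Spec.map (CommRingCat.ofHom (awayHom 𝒜 φ D hφ (s i))) z) := by
    rw [← Scheme.Hom.comp_apply, awayι_psi, Scheme.Hom.comp_apply]
  rw [e1]
  have e2 : ∀ (f : A) (a : ℕ) (hf : f ∈ 𝒜 a) (ha : 0 < a) (w : Spec (.of (Away 𝒜 f)))
      (g : A) (e : ℕ) (hg : g ∈ 𝒜 e) (he : 0 < e),
      (g ∉ (Proj.awayι 𝒜 f hf ha w).asHomogeneousIdeal ↔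
        Away.isLocalizationElem hf hg ∉ w.asIdeal) := by
    intro f a hf ha w g e hg he
    have := Proj.awayι_preimage_basicOpen 𝒜 hf ha hg he
    exact SetLike.ext_iff.mp this w
  rw [e2 _ _ _ _ _ _ _ hg he, e2 _ _ _ _ _ _ _ (hφ _ _ hg) (Nat.mul_pos hD he), not_iff_not]
  have e3 : Away.isLocalizationElem (hφ _ _ (hs i)) (hφ _ _ hg) =
      (awayHom 𝒜 φ D hφ (s i) (Away.isLocalizationElem (hs i) hg)) ^ D := by
    apply val_injective
    rw [val_pow, val_awayHom, Away.val_mk, Away.val_mk,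
      locMap_mk φ (s i) _ _ ⟨φ (s i) ^ e, ⟨e, rfl⟩⟩ (by simp), Localization.mk_pow]
    congr 1
    · simp [← pow_mul, mul_comm]
    · ext; simp [← pow_mul, mul_comm]
  rw [e3]
  exact (z.isPrime.pow_mem_iff_mem _ hD).symm


lemma psi_isFinite [Algebra.FiniteType (𝒜 0) A] (h0 : ∀ a ∈ 𝒜 0, φ a = a)
    (hcov' : ∀ x : Proj 𝒜, ∃ i, s i ∉ x.asHomogeneousIdeal) :
    IsFinite (psi 𝒜 φ D hφ s m hs hm hD hcov) := by
  rw [IsFinite.iff_isProper_and_isAffineHom]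
  constructor
  · have h1 : IsProper (psi 𝒜 φ D hφ s m hs hm hD hcov ≫ Proj.toSpecZero 𝒜) := by
      rw [psi_toSpecZero 𝒜 φ D hφ s m hs hm hD hcov h0]; infer_instance
    exact MorphismProperty.of_postcomp (W := @IsProper) (W' := @IsSeparated) _
      (Proj.toSpecZero 𝒜) inferInstance h1
  · apply isAffineHom_of_forall_exists_isAffineOpen
    intro x
    obtain ⟨i, hi⟩ := hcov' x
    refine ⟨Proj.basicOpen 𝒜 (s i), hi, Proj.isAffineOpen_basicOpen 𝒜 _ (hs i) (hm i), ?_⟩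
    have : psi 𝒜 φ D hφ s m hs hm hD hcov ⁻¹ᵁ Proj.basicOpen 𝒜 (s i) =
        Proj.basicOpen 𝒜 (φ (s i)) := by
      ext x
      exact not_congr (psi_mem 𝒜 φ D hφ s m hs hm hD hcov (hs i) (hm i) x)
    rw [this]
    exact Proj.isAffineOpen_basicOpen 𝒜 _ (hφ _ _ (hs i)) (Nat.mul_pos hD (hm i))

end ScaledProj

attribute [local instance] MvPolynomial.gradedAlgebra

namespace ProjPts

universe u
variable {k : Type u} [Field k] {n : ℕ}

lemma X_not_all_mem (x : Proj (homogeneousSubmodule (Fin (n + 1)) k)) :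
    ∃ i, (X i : MvPolynomial (Fin (n+1)) k) ∉ x.asHomogeneousIdeal := by
  by_contra! h
  apply x.not_irrelevant_le
  intro a ha
  have hle : Ideal.span (Set.range (X : Fin (n+1) → MvPolynomial (Fin (n+1)) k)) ≤
      x.asHomogeneousIdeal.toIdeal := by
    rw [Ideal.span_le]; rintro _ ⟨i, rfl⟩; exact h i
  apply hle
  rw [HomogeneousIdeal.mem_irrelevant_iff] at ha
  rw [← Set.image_univ, MvPolynomial.mem_ideal_span_X_image]
  intro d hd
  by_contra! hz
  have hd0 : d = 0 := by ext i; simpa using hz i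
  subst hd0
  have : coeff 0 a = 0 := by
    have h2 := congrArg (coeff 0) ha
    rw [GradedRing.proj_apply] at h2
    erw [MvPolynomial.decomposition.decompose'_apply] at h2
    simpa [coeff_homogeneousComponent] using h2
  simp [this] at hd

lemma pt_le (c : Fin (n+1)) (x y : Proj (homogeneousSubmodule (Fin (n + 1)) k))
    (hx : ∀ j, j ≠ c → (X j : MvPolynomial (Fin (n+1)) k) ∈ x.asHomogeneousIdeal)
    (hy : ∀ j, j ≠ c → (X j : MvPolynomial (Fin (n+1)) k) ∈ y.asHomogeneousIdeal) :
    x.asHomogeneousIdeal.toIdeal ≤ y.asHomogeneousIdeal.toIdeal := by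
  have hc : X c ∉ x.asHomogeneousIdeal := by
    obtain ⟨i, hi⟩ := X_not_all_mem x
    by_cases h : i = c
    · rwa [← h]
    · exact absurd (hx i h) hi
  -- every monomial of positive degree in a variable other than `c` is in both
  have hmon : ∀ (z : Proj (homogeneousSubmodule (Fin (n + 1)) k)) 
    (_ : ∀ j, j ≠ c → (X j : MvPolynomial (Fin (n+1)) k) ∈ z.asHomogeneousIdeal)
    (a : MvPolynomial (Fin (n+1)) k) (e : ℕ) (_ : a.IsHomogeneous e), 
    ∃ r : k, a - C r * X c ^ e ∈ z.asHomogeneousIdeal.toIdeal ∧ 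
      r = coeff (Finsupp.single c e) a := by
    intro z hz a e ha
    refine ⟨_, ?_, rfl⟩
    have hle : Ideal.span (Set.image (X : Fin (n+1) → MvPolynomial (Fin (n+1)) k) {j | j ≠ c}) ≤
        z.asHomogeneousIdeal.toIdeal := by
      rw [Ideal.span_le]; rintro _ ⟨i, hi, rfl⟩; exact hz i hi
    apply hle
    rw [MvPolynomial.mem_ideal_span_X_image]
    intro d hd
    by_contra! hzz
    have hd1 : d = Finsupp.single c (d c) := by
      ext i
      by_cases h : i = c
      · subst h; simp
      · simp [Ne.symm h, hzz i h]
    rw [mem_support_iff, coeff_sub, coeff_C_mul, coeff_X_pow] at hd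
    by_cases h : Finsupp.single c e = d
    · subst h; simp at hd
    · have : d.degree ≠ e := by
        intro h2
        apply h
        rw [hd1] at h2 ⊢
        simp at h2
        rw [h2]
      rw [if_neg h, ha.coeff_eq_zero this] at hd
      simp at hd
  intro a ha
  rw [mem_iff_homogeneousComponent_mem y.asHomogeneousIdeal.isHomogeneous]
  intro e
  have hae := homogeneousComponent_mem_of_mem x.asHomogeneousIdeal.isHomogeneous ha e
  have hh := homogeneousComponent_isHomogeneous e a
  obtain ⟨r, h1, hr⟩ := hmon x hx _ e hh
  obtain ⟨r', h2, hr'⟩ := hmon y hy _ e hh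
  obtain rfl : r = r' := hr.trans hr'.symm
  have h3 : C r * X c ^ e ∈ x.asHomogeneousIdeal.toIdeal := by
    have := Ideal.sub_mem _ hae h1
    simpa using this
  have hr0 : r = 0 := by
    by_contra hne
    rcases x.isPrime.mem_or_mem h3 with h4 | h4
    · apply x.isPrime.ne_top
      apply Ideal.eq_top_of_isUnit_mem _ h4
      exact (isUnit_iff_ne_zero.mpr hne).map C
    · exact hc (x.isPrime.mem_of_pow_mem _ h4)
  simpa [hr0] using h2

lemma pt_eq (c : Fin (n+1)) (x y : Proj (homogeneousSubmodule (Fin (n + 1)) k))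
    (hx : ∀ j, j ≠ c → (X j : MvPolynomial (Fin (n+1)) k) ∈ x.asHomogeneousIdeal)
    (hy : ∀ j, j ≠ c → (X j : MvPolynomial (Fin (n+1)) k) ∈ y.asHomogeneousIdeal) : x = y := by
  apply ProjectiveSpectrum.ext
  apply HomogeneousIdeal.toIdeal_injective
  exact le_antisymm (pt_le c x y hx hy) (pt_le c y x hy hx)

/-- evaluation at a coordinate point -/
noncomputable def evalPt (c : Fin (n+1)) : MvPolynomial (Fin (n+1)) k →+*
    homogeneousSubmodule (Fin (n + 1)) k 0 :=
  (aeval (R := k) (fun j => if j = c then (1 : homogeneousSubmodule (Fin (n + 1)) k 0) else 0)).toRingHom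

lemma evalPt_algebraMap (c : Fin (n+1)) :
    (evalPt c).comp (algebraMap (homogeneousSubmodule (Fin (n + 1)) k 0) _) =
      RingHom.id _ := by
  refine RingHom.ext fun a ↦ ?_
  obtain ⟨a, ha⟩ := a
  have : ∃ r, a = C r := by
    rw [mem_homogeneousSubmodule, ← totalDegree_zero_iff_isHomogeneous] at ha
    exact ⟨_, totalDegree_eq_zero_iff_eq_C.mp ha⟩
  obtain ⟨r, rfl⟩ := this
  change evalPt c (C r) = _
  simp [evalPt]
  rfl

lemma bijective_residueFieldMap_of_eq_id {S : Scheme.{u}} (f : S ⟶ S) (hf : f = 𝟙 S) (pt : S) :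
    Function.Bijective (f.residueFieldMap pt).hom := by
  subst hf
  rw [Scheme.residueFieldMap_id]
  exact Function.bijective_id

lemma isIso_residueFieldMap_of_section {S Y : Scheme.{u}} (g : S ⟶ Y) (π : Y ⟶ S)
    (hg : g ≫ π = 𝟙 S) (pt : S) : IsIso (π.residueFieldMap (g pt)) := by
  have h3 := bijective_residueFieldMap_of_eq_id (g ≫ π) hg pt
  rw [Scheme.residueFieldMap_comp] at h3
  rw [ConcreteCategory.isIso_iff_bijective]
  refine ⟨RingHom.injective (π.residueFieldMap (g pt)).hom, fun z ↦ ?_⟩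
  obtain ⟨w, hw⟩ := h3.2 ((g.residueFieldMap pt).hom z)
  exact ⟨w, (RingHom.injective (g.residueFieldMap pt).hom) hw⟩

lemma exists_rational (c : Fin (n+1)) :
    ∃ x : Proj (homogeneousSubmodule (Fin (n + 1)) k),
      (∀ j, j ≠ c → (X j : MvPolynomial (Fin (n+1)) k) ∈ x.asHomogeneousIdeal) ∧
      IsIso ((Proj.toSpecZero (homogeneousSubmodule (Fin (n + 1)) k)).residueFieldMap x) := by
  let S : Scheme := Spec (.of (homogeneousSubmodule (Fin (n + 1)) k 0))
  let f : MvPolynomial (Fin (n+1)) k →+* Γ(S, ⊤) :=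
    (Scheme.ΓSpecIso (.of (homogeneousSubmodule (Fin (n + 1)) k 0))).inv.hom.comp (evalPt c)
  have hf : (HomogeneousIdeal.irrelevant (homogeneousSubmodule (Fin (n + 1)) k)).toIdeal.map f = ⊤ := by
    rw [Ideal.eq_top_iff_one]
    have : f (X c) = 1 := by simp [f, evalPt]
    rw [← this]
    apply Ideal.mem_map_of_mem
    exact HomogeneousIdeal.mem_irrelevant_of_mem _ one_pos (isHomogeneous_X k c)
  let g := Proj.fromOfGlobalSections (homogeneousSubmodule (Fin (n + 1)) k) f hf
  have hg : g ≫ Proj.toSpecZero (homogeneousSubmodule (Fin (n + 1)) k) = 𝟙 _ := by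
    rw [Proj.fromOfGlobalSections_toSpecZero]
    rw [RingHom.comp_assoc, evalPt_algebraMap]
    simp [S]
  have : Nontrivial (homogeneousSubmodule (Fin (n + 1)) k 0) :=
    (algebraMap (homogeneousSubmodule (Fin (n + 1)) k 0)
      (MvPolynomial (Fin (n+1)) k)).domain_nontrivial
  obtain ⟨pt⟩ : Nonempty S :=
    inferInstanceAs (Nonempty (PrimeSpectrum (homogeneousSubmodule (Fin (n + 1)) k 0)))
  refine ⟨g pt, ?_, ?_⟩
  · intro j hj
    by_contra h
    have h2 : pt ∈ g ⁻¹ᵁ Proj.basicOpen (homogeneousSubmodule (Fin (n + 1)) k) (X j) := h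
    rw [Proj.fromOfGlobalSections_preimage_basicOpen _ _ _ one_pos (isHomogeneous_X k j)] at h2
    have : f (X j) = 0 := by simp [f, evalPt, hj]
    rw [this] at h2
    simp at h2
  · exact isIso_residueFieldMap_of_section g _ hg pt

lemma mem_zero_eq_C {a : MvPolynomial (Fin (n+1)) k}
    (ha : a ∈ homogeneousSubmodule (Fin (n + 1)) k 0) : ∃ r, a = C r := by
  rw [mem_homogeneousSubmodule, ← totalDegree_zero_iff_isHomogeneous] at ha
  exact ⟨_, totalDegree_eq_zero_iff_eq_C.mp ha⟩

lemma finiteType_zero :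
    Algebra.FiniteType (homogeneousSubmodule (Fin (n + 1)) k 0) (MvPolynomial (Fin (n+1)) k) := by
  classical
  refine ⟨⟨Finset.univ.image X, ?_⟩⟩
  rw [eq_top_iff]
  intro a _
  induction a using MvPolynomial.induction_on with
  | C r =>
    have h : (C r : MvPolynomial (Fin (n+1)) k) ∈ homogeneousSubmodule (Fin (n + 1)) k 0 :=
      isHomogeneous_C _ r
    exact Subalgebra.algebraMap_mem _ (⟨C r, h⟩ : homogeneousSubmodule (Fin (n + 1)) k 0)
  | add p q hp hq => exact add_mem (hp trivial) (hq trivial)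
  | mul_X p i hp =>
    exact mul_mem (hp trivial) (Algebra.subset_adjoin (by simp))

lemma eq_of_le_of_closed {x y : Proj (homogeneousSubmodule (Fin (n + 1)) k)}
    (hx : IsClosed ({x} : Set (Proj (homogeneousSubmodule (Fin (n + 1)) k))))
    (h : x.asHomogeneousIdeal.toIdeal ≤ y.asHomogeneousIdeal.toIdeal) : y = x := by
  have h1 := (ProjectiveSpectrum.le_iff_mem_closure (homogeneousSubmodule (Fin (n + 1)) k) x y).mp h
  have h2 : closure ({x} : Set (ProjectiveSpectrum (homogeneousSubmodule (Fin (n + 1)) k))) = {x} :=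
    IsClosed.closure_eq hx
  have h3 : y ∈ ({x} : Set (ProjectiveSpectrum (homogeneousSubmodule (Fin (n + 1)) k))) :=
    h2.subset h1
  exact h3

lemma exists_homogeneous_diff {x t : Proj (homogeneousSubmodule (Fin (n + 1)) k)}
    (h : ¬ x.asHomogeneousIdeal.toIdeal ≤ t.asHomogeneousIdeal.toIdeal) :
    ∃ (d : ℕ) (a : MvPolynomial (Fin (n+1)) k), a.IsHomogeneous d ∧
      a ∈ x.asHomogeneousIdeal.toIdeal ∧ a ∉ t.asHomogeneousIdeal.toIdeal := by
  obtain ⟨a, ha, hat⟩ := Set.not_subset.mp h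
  have h2 := mt (mem_iff_homogeneousComponent_mem t.asHomogeneousIdeal.isHomogeneous a).mpr hat
  push Not at h2
  obtain ⟨d, hd⟩ := h2
  exact ⟨d, _, homogeneousComponent_isHomogeneous d a,
    homogeneousComponent_mem_of_mem x.asHomogeneousIdeal.isHomogeneous ha d, hd⟩

lemma exists_homogeneous_diff_finset (t : Proj (homogeneousSubmodule (Fin (n + 1)) k))
    (S : Finset (Proj (homogeneousSubmodule (Fin (n + 1)) k)))
    (hS : ∀ s ∈ S, ¬ s.asHomogeneousIdeal.toIdeal ≤ t.asHomogeneousIdeal.toIdeal) :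
    ∃ (d : ℕ) (a : MvPolynomial (Fin (n+1)) k), 0 < d ∧ a.IsHomogeneous d ∧
      (∀ s ∈ S, a ∈ s.asHomogeneousIdeal.toIdeal) ∧ a ∉ t.asHomogeneousIdeal.toIdeal := by
  classical
  induction S using Finset.induction_on with
  | empty =>
    obtain ⟨i, hi⟩ := X_not_all_mem t
    exact ⟨1, X i, one_pos, isHomogeneous_X k i, by simp, hi⟩
  | insert s S hs ih =>
    obtain ⟨d, a, hd, ha, haS, hat⟩ := ih fun s hs => hS s (Finset.mem_insert_of_mem hs)
    obtain ⟨e, b, hb, hbs, hbt⟩ := exists_homogeneous_diff (hS s (Finset.mem_insert_self _ _))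
    refine ⟨d + e, a * b, by omega, ha.mul hb, ?_, ?_⟩
    · intro s' hs'
      rcases Finset.mem_insert.mp hs' with rfl | h
      · exact Ideal.mul_mem_left _ _ hbs
      · exact Ideal.mul_mem_right _ _ (haS _ h)
    · intro h
      rcases t.isPrime.mem_or_mem h with h | h
      exacts [hat h, hbt h]

/-- homogeneous prime avoidance for pairwise incomparable points -/
lemma avoid (x : Proj (homogeneousSubmodule (Fin (n + 1)) k))
    (T : Finset (Proj (homogeneousSubmodule (Fin (n + 1)) k)))
    (hT : ∀ s ∈ T, ∀ t ∈ T, s.asHomogeneousIdeal.toIdeal ≤ t.asHomogeneousIdeal.toIdeal → s = t)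
    (hx : ∀ t ∈ T, ¬ x.asHomogeneousIdeal.toIdeal ≤ t.asHomogeneousIdeal.toIdeal) :
    ∃ (d : ℕ) (a : MvPolynomial (Fin (n+1)) k), 0 < d ∧ a.IsHomogeneous d ∧
      a ∈ x.asHomogeneousIdeal.toIdeal ∧ ∀ t ∈ T, a ∉ t.asHomogeneousIdeal.toIdeal := by
  classical
  induction T using Finset.induction_on with
  | empty => exact ⟨1, 0, one_pos, isHomogeneous_zero _ _ _, Ideal.zero_mem _, by simp⟩
  | insert t T ht ih =>
    obtain ⟨d, a, hd, ha, hax, haT⟩ := ih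
      (fun s hs s' hs' => hT s (Finset.mem_insert_of_mem hs) s' (Finset.mem_insert_of_mem hs'))
      (fun s hs => hx s (Finset.mem_insert_of_mem hs))
    by_cases hat : a ∈ t.asHomogeneousIdeal.toIdeal
    · obtain ⟨e, b, he, hb, hbS, hbt⟩ := exists_homogeneous_diff_finset t (insert x T) (by
        intro s hs hle
        rcases Finset.mem_insert.mp hs with rfl | h
        · exact hx t (Finset.mem_insert_self _ _) hle
        · have := hT s (Finset.mem_insert_of_mem h) t (Finset.mem_insert_self _ _) hle
          exact ht (this ▸ h))
      refine ⟨d * e, a ^ e + b ^ d, Nat.mul_pos hd he, ?_, ?_, ?_⟩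
      · refine (ha.pow e).add ?_
        rw [mul_comm]; exact hb.pow d
      · exact Ideal.add_mem _ (Ideal.pow_mem_of_mem _ hax _ he)
          (Ideal.pow_mem_of_mem _ (hbS _ (Finset.mem_insert_self _ _)) _ hd)
      · intro s hs h
        rcases Finset.mem_insert.mp hs with rfl | h'
        · exact hbt (s.isPrime.mem_of_pow_mem _
            ((Ideal.add_mem_iff_right _ (Ideal.pow_mem_of_mem _ hat _ he)).mp h))
        · exact haT s h' (s.isPrime.mem_of_pow_mem _
            ((Ideal.add_mem_iff_left _ (Ideal.pow_mem_of_mem _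
              (hbS s (Finset.mem_insert_of_mem h')) _ hd)).mp h))
    · refine ⟨d, a, hd, ha, hax, ?_⟩
      intro s hs
      rcases Finset.mem_insert.mp hs with rfl | h'
      exacts [hat, haT s h']

lemma exists_F {N : ℕ} (p : Fin N → Proj (homogeneousSubmodule (Fin (n + 1)) k))
    (hclosed : ∀ i, IsClosed ({p i} : Set (Proj (homogeneousSubmodule (Fin (n + 1)) k))))
    (J : Ideal (MvPolynomial (Fin (n+1)) k))
    (hJ : J.IsHomogeneous (homogeneousSubmodule (Fin (n + 1)) k))
    (hJp : ∀ i, ¬ J ≤ (p i).asHomogeneousIdeal.toIdeal) (j : Fin (n+1)) :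
    ∃ (d : ℕ) (F : MvPolynomial (Fin (n+1)) k), 0 < d ∧ F.IsHomogeneous d ∧
      (∀ i, F ∈ (p i).asHomogeneousIdeal.toIdeal) ∧ X j ^ d - F ∈ J := by
  have hI : (J ⊔ ⨅ i, (p i).asHomogeneousIdeal.toIdeal).IsHomogeneous
      (homogeneousSubmodule (Fin (n + 1)) k) :=
    hJ.sup (Ideal.IsHomogeneous.iInf fun i => (p i).asHomogeneousIdeal.isHomogeneous)
  have hrad : (X j : MvPolynomial (Fin (n+1)) k) ∈
      (J ⊔ ⨅ i, (p i).asHomogeneousIdeal.toIdeal).radical := by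
    rw [hI.radical_eq, Ideal.mem_sInf]
    rintro P ⟨hP, hle, hprime⟩
    by_contra hj
    let y : Proj (homogeneousSubmodule (Fin (n + 1)) k) :=
      ⟨⟨P, hP⟩, hprime, fun h => hj (h
        (HomogeneousIdeal.mem_irrelevant_of_mem _ one_pos (isHomogeneous_X k j)))⟩
    have h1 : (Finset.univ : Finset (Fin N)).inf (fun i => (p i).asHomogeneousIdeal.toIdeal) ≤ P := by
      rw [Finset.inf_univ_eq_iInf]
      exact le_sup_right.trans hle
    obtain ⟨i, -, hi⟩ := (Ideal.IsPrime.inf_le' hprime).mp h1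
    have h2 : y = p i := eq_of_le_of_closed (hclosed i) hi
    apply hJp i
    rw [← h2]
    exact le_sup_left.trans hle
  obtain ⟨M, hM⟩ := hrad
  have hM' := Ideal.mul_mem_right (X j) _ hM
  rw [← pow_succ] at hM'
  obtain ⟨u, hu, v, hv, huv⟩ := Submodule.mem_sup.mp hM'
  have hX : (X j ^ (M+1) : MvPolynomial (Fin (n+1)) k).IsHomogeneous (M+1) := by
    simpa using (isHomogeneous_X k j).pow (M+1)
  refine ⟨M + 1, homogeneousComponent (M+1) v, by omega,
    homogeneousComponent_isHomogeneous _ _, fun i => ?_, ?_⟩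
  · exact homogeneousComponent_mem_of_mem (p i).asHomogeneousIdeal.isHomogeneous
      ((Ideal.mem_iInf.mp hv) i) _
  · have h3 := congrArg (homogeneousComponent (M+1)) huv
    rw [map_add, homogeneousComponent_eq_self hX] at h3
    rw [← h3, add_sub_cancel_right]
    exact homogeneousComponent_mem_of_mem hJ hu _

lemma exists_G (hn : 1 ≤ n) {N : ℕ} (i0 : Fin N)
    (p : Fin N → Proj (homogeneousSubmodule (Fin (n + 1)) k))
    (hclosed : ∀ i, IsClosed ({p i} : Set (Proj (homogeneousSubmodule (Fin (n + 1)) k))))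
    (honH : ∀ i : Fin N, i ≠ i0 → X 0 ∈ (p i).asHomogeneousIdeal)
    (hoffH : X 0 ∉ (p i0).asHomogeneousIdeal) :
    ∃ (d : Fin (n+1) → ℕ) (G : Fin (n+1) → MvPolynomial (Fin (n+1)) k),
      (∀ j, 0 < d j) ∧ (∀ j, (G j).IsHomogeneous (d j)) ∧
      (∀ x : Proj (homogeneousSubmodule (Fin (n + 1)) k), ∃ j, G j ∉ x.asHomogeneousIdeal) ∧
      (∀ i, i ≠ i0 → ∀ j, j ≠ ⟨1, by omega⟩ → G j ∈ (p i).asHomogeneousIdeal) ∧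
      (∀ j, j ≠ 0 → G j ∈ (p i0).asHomogeneousIdeal) := by
  classical
  let c1 : Fin (n+1) := ⟨1, by omega⟩
  have hc1 : (0 : Fin (n+1)) ≠ c1 := by simp [c1, Fin.ext_iff]
  obtain ⟨e, he, -⟩ := exists_rational (k := k) c1
  obtain ⟨dh, h, hdh, hh, hh0, hhT⟩ := avoid (p i0)
    (insert e ((Finset.univ.filter (· ≠ i0)).image p)) (by
      intro s hs t ht hle
      rcases Finset.mem_insert.mp hs with rfl | hs
      · exact pt_eq c1 _ _ he fun j hj => hle (he j hj)
      · obtain ⟨i, -, rfl⟩ := Finset.mem_image.mp hs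
        exact (eq_of_le_of_closed (hclosed i) hle).symm) (by
      intro t ht hle
      have heq := eq_of_le_of_closed (hclosed i0) hle
      subst heq
      rcases Finset.mem_insert.mp ht with h | h
      · apply hoffH
        rw [h]
        exact he 0 hc1
      · obtain ⟨i, hi, hi2⟩ := Finset.mem_image.mp h
        apply hoffH
        rw [← hi2]
        exact honH i (by simpa using hi))
  have hhe : h ∉ e.asHomogeneousIdeal.toIdeal := hhT e (Finset.mem_insert_self _ _)
  have hhp : ∀ i, i ≠ i0 → h ∉ (p i).asHomogeneousIdeal.toIdeal := fun i hi =>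
    hhT _ (Finset.mem_insert_of_mem (Finset.mem_image.mpr ⟨i, by simpa using hi, rfl⟩))
  have hJ : (Ideal.span {X 0, h} : Ideal (MvPolynomial (Fin (n+1)) k)).IsHomogeneous
      (homogeneousSubmodule (Fin (n + 1)) k) := by
    apply Ideal.homogeneous_span
    rintro x (rfl | rfl)
    · exact ⟨1, isHomogeneous_X k 0⟩
    · exact ⟨dh, hh⟩
  have hX0 : X 0 ∈ (Ideal.span {X 0, h} : Ideal (MvPolynomial (Fin (n+1)) k)) :=
    Ideal.subset_span (by simp)
  have hhJ : h ∈ (Ideal.span {X 0, h} : Ideal (MvPolynomial (Fin (n+1)) k)) :=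
    Ideal.subset_span (by simp)
  choose d F hd hF hFp hFJ using exists_F p hclosed _ hJ (by
    intro i hle
    by_cases hi : i = i0
    · subst hi; exact hoffH (hle hX0)
    · exact hhp i hi (hle hhJ))
  refine ⟨fun j => if j = 0 then 1 else if j = c1 then dh else d j,
    fun j => if j = 0 then X 0 else if j = c1 then h else F j, ?_, ?_, ?_, ?_, ?_⟩
  · intro j
    dsimp only
    split_ifs
    exacts [one_pos, hdh, hd j]
  · intro j
    dsimp only
    split_ifs
    exacts [isHomogeneous_X k 0, hh, hF j]
  · intro x
    by_contra! hx
    have hx0 : X 0 ∈ x.asHomogeneousIdeal.toIdeal := by simpa using hx 0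
    have hxh : h ∈ x.asHomogeneousIdeal.toIdeal := by simpa [hc1.symm] using hx c1
    have hle : Ideal.span {X 0, h} ≤ x.asHomogeneousIdeal.toIdeal := by
      rw [Ideal.span_le]
      rintro _ (rfl | rfl)
      exacts [hx0, hxh]
    have hxe : x = e := by
      refine pt_eq c1 _ _ (fun j hj => ?_) he
      by_cases hj0 : j = 0
      · subst hj0; exact hx0
      · have hFx : F j ∈ x.asHomogeneousIdeal.toIdeal := by simpa [hj0, hj] using hx j
        have := Ideal.add_mem _ (hle (hFJ j)) hFx
        rw [sub_add_cancel] at this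
        exact x.isPrime.mem_of_pow_mem _ this
    rw [hxe] at hxh
    exact hhe hxh
  · intro i hi j hj
    have hj' : j ≠ c1 := hj
    dsimp only
    split_ifs with h1
    exacts [honH i hi, hFp j i]
  · intro j hj
    dsimp only
    rw [if_neg hj]
    split_ifs
    exacts [hh0, hFp j i0]

lemma main (hn : 1 ≤ n) {N : ℕ} (i0 : Fin N)
    (p : Fin N → Proj (homogeneousSubmodule (Fin (n + 1)) k))
    (hclosed : ∀ i, IsClosed ({p i} : Set (Proj (homogeneousSubmodule (Fin (n + 1)) k))))
    (honH : ∀ i : Fin N, i ≠ i0 → X 0 ∈ (p i).asHomogeneousIdeal)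
    (hoffH : X 0 ∉ (p i0).asHomogeneousIdeal) :
    ∃ ψ : Proj (homogeneousSubmodule (Fin (n + 1)) k) ⟶
        Proj (homogeneousSubmodule (Fin (n + 1)) k),
      IsFinite ψ ∧
      ψ ≫ Proj.toSpecZero (homogeneousSubmodule (Fin (n + 1)) k)
        = Proj.toSpecZero (homogeneousSubmodule (Fin (n + 1)) k) ∧
      ∃ y z : Proj (homogeneousSubmodule (Fin (n + 1)) k),
        IsIso ((Proj.toSpecZero (homogeneousSubmodule (Fin (n + 1)) k)).residueFieldMap y) ∧
        IsIso ((Proj.toSpecZero (homogeneousSubmodule (Fin (n + 1)) k)).residueFieldMap z) ∧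
        y ≠ z ∧
        (∀ i : Fin N, i ≠ i0 → ψ (p i) = y) ∧
        ψ (p i0) = z := by
  obtain ⟨d, G, hd, hG, hGx, hGq, hGp⟩ := exists_G hn i0 p hclosed honH hoffH
  let D := ∏ j, d j
  have hD : 0 < D := Finset.prod_pos fun j _ => hd j
  have hdvd : ∀ j, d j * (D / d j) = D := fun j =>
    Nat.mul_div_cancel' (Finset.dvd_prod_of_mem d (Finset.mem_univ j))
  have hpos : ∀ j, 0 < D / d j := fun j => by
    by_contra h0
    have h1 := hdvd j
    rw [Nat.eq_zero_of_not_pos h0, mul_zero] at h1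
    omega
  let f : Fin (n+1) → MvPolynomial (Fin (n+1)) k := fun j => G j ^ (D / d j)
  have hf : ∀ j, (f j).IsHomogeneous D := fun j => by
    have := (hG j).pow (D / d j)
    rwa [hdvd] at this
  have hfx : ∀ (x : Proj (homogeneousSubmodule (Fin (n + 1)) k)) j,
      f j ∈ x.asHomogeneousIdeal ↔ G j ∈ x.asHomogeneousIdeal := fun x j =>
    x.isPrime.pow_mem_iff_mem _ (hpos j)
  let φ : MvPolynomial (Fin (n+1)) k →+* MvPolynomial (Fin (n+1)) k := (aeval (R := k) f).toRingHom
  have hφX : ∀ j, φ (X j) = f j := fun j => by simp [φ]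
  have hφ : ∀ m a, a ∈ homogeneousSubmodule (Fin (n + 1)) k m →
      φ a ∈ homogeneousSubmodule (Fin (n + 1)) k (D * m) := fun m a ha =>
    IsHomogeneous.aeval (S := k) ha f hf
  have h0 : ∀ a ∈ homogeneousSubmodule (Fin (n + 1)) k 0, φ a = a := fun a ha => by
    obtain ⟨r, rfl⟩ := mem_zero_eq_C ha
    simp [φ]
  have hcov : ∀ x : Proj (homogeneousSubmodule (Fin (n + 1)) k), ∃ i,
      φ (X i) ∉ x.asHomogeneousIdeal := fun x => by
    obtain ⟨j, hj⟩ := hGx x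
    refine ⟨j, ?_⟩
    rw [hφX, hfx]
    exact hj
  have hs : ∀ i, (X i : MvPolynomial (Fin (n+1)) k) ∈ homogeneousSubmodule (Fin (n + 1)) k 1 :=
    fun i => isHomogeneous_X k i
  have := finiteType_zero (k := k) (n := n)
  obtain ⟨y, hy, hyi⟩ := exists_rational (k := k) (n := n) ⟨1, by omega⟩
  obtain ⟨z, hz, hzi⟩ := exists_rational (k := k) (n := n) 0
  have hmem : ∀ x j, X j ∈ (ScaledProj.psi (homogeneousSubmodule (Fin (n + 1)) k) φ D hφ X
      (fun _ => 1) hs (fun _ => one_pos) hD hcov x).asHomogeneousIdeal ↔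
      G j ∈ x.asHomogeneousIdeal := fun x j => by
    rw [ScaledProj.psi_mem _ _ _ _ _ _ _ _ _ _ (hs j) one_pos, hφX, hfx]
  refine ⟨ScaledProj.psi (homogeneousSubmodule (Fin (n + 1)) k) φ D hφ X (fun _ => 1) hs
    (fun _ => one_pos) hD hcov, ScaledProj.psi_isFinite _ _ _ _ _ _ _ _ _ _ h0 X_not_all_mem,
    ScaledProj.psi_toSpecZero _ _ _ _ _ _ _ _ _ _ h0, y, z, hyi, hzi, ?_, ?_, ?_⟩
  · rintro rfl
    obtain ⟨i, hi⟩ := X_not_all_mem y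
    by_cases h : i = 0
    · subst h
      exact hi (hy 0 (by simp [Fin.ext_iff]))
    · exact hi (hz i h)
  · intro i hi
    exact pt_eq _ _ _ (fun j hj => (hmem _ j).mpr (hGq i hi j hj)) hy
  · exact pt_eq _ _ _ (fun j hj => (hmem _ j).mpr (hGp j hj)) hz

end ProjPts

/-- Let `k` be a field, `n ≥ 1`, and `H ⊂ ℙⁿ_k` the hyperplane `W₀ = 0`
(`ℙⁿ_k = Proj k[W₀,…,Wₙ]`).  Given `N ≥ 2` closed points `p 0, p 1, …, p (N-1)` of `ℙⁿ_k`
with `p 1, …, p (N-1)` lying on `H` and `p 0` off `H`, there are a finite morphism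
`ψ : ℙⁿ_k ⟶ ℙⁿ_k` of `k`-schemes (i.e. commuting with the structure morphism
`Proj.toSpecZero`) and two distinct `k`-rational points `y z` of `ℙⁿ_k` (rationality being
expressed by the residue-field map along the structure morphism being an isomorphism) such
that `ψ` sends `p i` to `y` for all `i ≠ 0` and sends `p 0` to `z`. -/
theorem exists_finite_endomorphism_contracting_hyperplane_points
    (k : Type*) [Field k] (n : ℕ) (hn : 1 ≤ n) (N : ℕ) (hN : 2 ≤ N)
    (p : Fin N → Proj (homogeneousSubmodule (Fin (n + 1)) k))
    (hclosed : ∀ i, IsClosed ({p i} : Set (Proj (homogeneousSubmodule (Fin (n + 1)) k))))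
    (honH : ∀ i : Fin N, i ≠ ⟨0, by omega⟩ → X 0 ∈ (p i).asHomogeneousIdeal)
    (hoffH : X 0 ∉ (p ⟨0, by omega⟩).asHomogeneousIdeal) :
    ∃ ψ : Proj (homogeneousSubmodule (Fin (n + 1)) k) ⟶
        Proj (homogeneousSubmodule (Fin (n + 1)) k),
      IsFinite ψ ∧
      ψ ≫ Proj.toSpecZero (homogeneousSubmodule (Fin (n + 1)) k)
        = Proj.toSpecZero (homogeneousSubmodule (Fin (n + 1)) k) ∧
      ∃ y z : Proj (homogeneousSubmodule (Fin (n + 1)) k),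
        IsIso ((Proj.toSpecZero (homogeneousSubmodule (Fin (n + 1)) k)).residueFieldMap y) ∧
        IsIso ((Proj.toSpecZero (homogeneousSubmodule (Fin (n + 1)) k)).residueFieldMap z) ∧
        y ≠ z ∧
        (∀ i : Fin N, i ≠ ⟨0, by omega⟩ → ψ.base (p i) = y) ∧
        ψ.base (p ⟨0, by omega⟩) = z := by
  exact ProjPts.main hn ⟨0, by omega⟩ p hclosed honH hoffH
end

section
/- Let k be a field and let q₀, q₁, …, q_n be pairwise distinct closed points of the projective line ℙ¹_k. Then there exists a non-constant morphism f : ℙ¹_k → ℙ¹_k of k-schemes such that f(q₀) = 0 and f(q_i) = ∞ for all 1 ≤ i ≤ n, where 0 and ∞ denote the k-rational points (0 : 1) and (1 : 0) of ℙ¹_k respectively. -/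
open AlgebraicGeometry CategoryTheory MvPolynomial

attribute [local instance] MvPolynomial.gradedAlgebra

namespace P1Aux

section

universe u

variable {A B : Type u} {σ τ : Type*} [CommRing A] [SetLike σ A] [AddSubgroupClass σ A]
  [CommRing B] [SetLike τ B] [AddSubgroupClass τ B]
  {𝒜 : ℕ → σ} {ℬ : ℕ → τ} [GradedRing 𝒜] [GradedRing ℬ]

open HomogeneousLocalization

/-- Map of numerators/denominators induced by a ring hom multiplying degrees by `d`. -/
def numDenMap (φ : A →+* B) (d : ℕ) (hφ : ∀ i x, x ∈ 𝒜 i → φ x ∈ ℬ (d * i)) (s : A) (t : B)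
    (h : φ s = t) (c : NumDenSameDeg 𝒜 (.powers s)) : NumDenSameDeg ℬ (.powers t) where
  deg := d * c.deg
  num := ⟨φ c.num, hφ _ _ c.num.2⟩
  den := ⟨φ c.den, hφ _ _ c.den.2⟩
  den_mem := by
    obtain ⟨n, hn⟩ := c.den_mem
    exact ⟨n, by simp [← h, ← hn]⟩

theorem powers_le (φ : A →+* B) (s : A) (t : B)
    (h : φ s = t) : Submonoid.powers s ≤ (Submonoid.powers t).comap φ := by
  rintro _ ⟨n, rfl⟩; exact ⟨n, by simp [h]⟩

theorem exists_awayHom (φ : A →+* B) (d : ℕ) (hφ : ∀ i x, x ∈ 𝒜 i → φ x ∈ ℬ (d * i)) (s : A) (t : B)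
    (h : φ s = t) : ∃ g : Away 𝒜 s →+* Away ℬ t, ∀ x, (g x).val =
      IsLocalization.map (Localization.Away t) φ (powers_le φ s t h) x.val := by
  have key : ∀ x : Away 𝒜 s, ∃ y : Away ℬ t, y.val =
      IsLocalization.map (Localization.Away t) φ (powers_le φ s t h) x.val := by
    intro x
    obtain ⟨c, rfl⟩ := HomogeneousLocalization.mk_surjective x
    refine ⟨HomogeneousLocalization.mk (numDenMap φ d hφ s t h c), ?_⟩
    rw [val_mk, val_mk, Localization.mk_eq_mk', Localization.mk_eq_mk', IsLocalization.map_mk']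
    rfl
  choose g hg using key
  refine ⟨⟨⟨⟨g, ?_⟩, ?_⟩, ?_, ?_⟩, hg⟩
  · exact val_injective _ (by simp [hg])
  · intro x y; exact val_injective _ (by simp [hg])
  · exact val_injective _ (by simp [hg])
  · intro x y; exact val_injective _ (by simp [hg])

/-- The map on homogeneous localizations induced by a ring hom multiplying degrees by `d`. -/
noncomputable def awayHom (φ : A →+* B) (d : ℕ) (hφ : ∀ i x, x ∈ 𝒜 i → φ x ∈ ℬ (d * i)) (s : A)
    (t : B) (h : φ s = t) : Away 𝒜 s →+* Away ℬ t :=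
  (exists_awayHom φ d hφ s t h).choose

theorem val_awayHom (φ : A →+* B) (d : ℕ) (hφ : ∀ i x, x ∈ 𝒜 i → φ x ∈ ℬ (d * i)) (s : A)
    (t : B) (h : φ s = t) (x : Away 𝒜 s) : (awayHom φ d hφ s t h x).val =
      IsLocalization.map (Localization.Away t) φ (powers_le φ s t h) x.val :=
  (exists_awayHom φ d hφ s t h).choose_spec x

theorem awayHom_awayMap (φ : A →+* B) (d : ℕ) (hφ : ∀ i x, x ∈ 𝒜 i → φ x ∈ ℬ (d * i))
    {s s' x : A} {t t' y : B} (h : φ s = t) {m m' : ℕ}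
    (hs' : s' ∈ 𝒜 m) (ht' : t' ∈ ℬ m') (hx : x = s * s') (hy : y = t * t') (hxy : φ x = y) :
    (awayHom (ℬ := ℬ) φ d hφ x y hxy).comp (awayMap 𝒜 hs' hx) =
      (awayMap ℬ ht' hy).comp (awayHom φ d hφ s t h) := by
  ext a
  rw [RingHom.comp_apply, RingHom.comp_apply, val_awayHom, val_awayMap, val_awayMap, val_awayHom]
  generalize a.val = z
  simp only [← RingHom.comp_apply]
  congr 1
  apply IsLocalization.ringHom_ext (M := .powers s)
  ext i
  simp

theorem val_fromZero (S : Submonoid A) (a : 𝒜 0) :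
    (fromZeroRingHom 𝒜 S a).val = algebraMap A (Localization S) a :=
  Localization.mk_one_eq_algebraMap _

theorem awayHom_fromZero (φ : A →+* B) (d : ℕ) (hφ : ∀ i x, x ∈ 𝒜 i → φ x ∈ ℬ (d * i))
    {s : A} {t : B} (h : φ s = t) (a : 𝒜 0) (b : ℬ 0) (hab : φ a = b) :
    awayHom φ d hφ s t h (fromZeroRingHom 𝒜 _ a) = fromZeroRingHom ℬ _ b := by
  ext
  rw [val_awayHom, val_fromZero, val_fromZero, IsLocalization.map_eq, hab]

/-- Affine open cover of `Proj ℬ` by basic opens. -/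
noncomputable def cover {ι : Type*} (t : ι → B) (m : ι → ℕ) (ht : ∀ i, t i ∈ ℬ (m i))
    (hm : ∀ i, 0 < m i) (hc : ∀ x : Proj ℬ, ∃ i, t i ∉ x.asHomogeneousIdeal) :
    (Proj ℬ).AffineOpenCover where
  I₀ := ι
  X i := .of (Away ℬ (t i))
  f i := Proj.awayι ℬ (t i) (ht i) (hm i)
  idx x := (hc x).choose
  covers x := by
    change x ∈ (Proj.awayι ℬ _ _ _).opensRange
    rw [Proj.opensRange_awayι]
    exact (hc x).choose_spec

theorem overlap (φ : A →+* B) (d : ℕ) (hφ : ∀ i x, x ∈ 𝒜 i → φ x ∈ ℬ (d * i))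
    {s s' : A} {t t' : B} (h : φ s = t) (h' : φ s' = t') {e e' m m' : ℕ}
    (hs : s ∈ 𝒜 e) (hs' : s' ∈ 𝒜 e') (ht : t ∈ ℬ m) (ht' : t' ∈ ℬ m')
    (he : 0 < e) (he' : 0 < e') (hm : 0 < m) (hm' : 0 < m') :
    Limits.pullback.fst (Proj.awayι ℬ t ht hm) (Proj.awayι ℬ t' ht' hm') ≫
      Spec.map (CommRingCat.ofHom (awayHom φ d hφ s t h)) ≫ Proj.awayι 𝒜 s hs he =
    Limits.pullback.snd (Proj.awayι ℬ t ht hm) (Proj.awayι ℬ t' ht' hm') ≫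
      Spec.map (CommRingCat.ofHom (awayHom φ d hφ s' t' h')) ≫ Proj.awayι 𝒜 s' hs' he' := by
  rw [← cancel_epi (Proj.pullbackAwayιIso ℬ ht hm ht' hm' rfl).inv,
    Proj.pullbackAwayιIso_inv_fst_assoc, Proj.pullbackAwayιIso_inv_snd_assoc,
    ← Spec.map_comp_assoc, ← Spec.map_comp_assoc, ← CommRingCat.ofHom_comp,
    ← CommRingCat.ofHom_comp,
    ← awayHom_awayMap φ d hφ h hs' ht' rfl rfl (by simp [h, h']),
    ← awayHom_awayMap φ d hφ h' hs ht (mul_comm s s') (mul_comm _ _) (by simp [h, h']),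
    CommRingCat.ofHom_comp, CommRingCat.ofHom_comp, Spec.map_comp_assoc, Spec.map_comp_assoc,
    Proj.SpecMap_awayMap_awayι, Proj.SpecMap_awayMap_awayι]
  rfl

/-- The glued morphism. -/
theorem exists_glue {ι : Type*} (φ : A →+* B) (d : ℕ) (hφ : ∀ i x, x ∈ 𝒜 i → φ x ∈ ℬ (d * i))
    (s : ι → A) (t : ι → B) (h : ∀ i, φ (s i) = t i) (e m : ι → ℕ)
    (hs : ∀ i, s i ∈ 𝒜 (e i)) (ht : ∀ i, t i ∈ ℬ (m i))
    (he : ∀ i, 0 < e i) (hm : ∀ i, 0 < m i)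
    (hc : ∀ x : Proj ℬ, ∃ i, t i ∉ x.asHomogeneousIdeal) :
    ∃ f : Proj ℬ ⟶ Proj 𝒜, ∀ i, Proj.awayι ℬ (t i) (ht i) (hm i) ≫ f =
      Spec.map (CommRingCat.ofHom (awayHom φ d hφ (s i) (t i) (h i))) ≫
        Proj.awayι 𝒜 (s i) (hs i) (he i) :=
  ⟨(cover t m ht hm hc).openCover.glueMorphisms
    (fun i ↦ Spec.map (CommRingCat.ofHom (awayHom φ d hφ (s i) (t i) (h i))) ≫
        Proj.awayι 𝒜 (s i) (hs i) (he i)) (fun i j ↦ overlap φ d hφ (h i) (h j) (hs i) (hs j)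
          (ht i) (ht j) (he i) (he j) (hm i) (hm j)),
    fun i ↦ (cover t m ht hm hc).openCover.ι_glueMorphisms _ _ i⟩

theorem exists_morphism {ι : Type*} (φ : A →+* B) (d : ℕ) (hd : 0 < d)
    (hφ : ∀ i x, x ∈ 𝒜 i → φ x ∈ ℬ (d * i))
    (s : ι → A) (t : ι → B) (h : ∀ i, φ (s i) = t i)
    (hs : ∀ i, s i ∈ 𝒜 1) (ht : ∀ i, t i ∈ ℬ d)
    (hc : ∀ x : Proj ℬ, ∃ i, t i ∉ x.asHomogeneousIdeal) :
    ∃ f : Proj ℬ ⟶ Proj 𝒜,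
      (∀ i x, s i ∈ (f.base x).asHomogeneousIdeal ↔ t i ∈ x.asHomogeneousIdeal) ∧
      ∀ ψ : 𝒜 0 →+* ℬ 0, (∀ a : 𝒜 0, φ a = ψ a) →
        f ≫ Proj.toSpecZero 𝒜 = Proj.toSpecZero ℬ ≫ Spec.map (CommRingCat.ofHom ψ) := by
  obtain ⟨f, hf⟩ := exists_glue φ d hφ s t h (fun _ ↦ 1) (fun _ ↦ d) hs ht (fun _ ↦ one_pos)
    (fun _ ↦ hd) hc
  refine ⟨f, fun i x ↦ ?_, fun ψ hψ ↦ ?_⟩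
  · obtain ⟨j, hj⟩ := hc x
    have hx : x ∈ (Proj.awayι ℬ (t j) (ht j) hd).opensRange := by
      rw [Proj.opensRange_awayι]; exact hj
    obtain ⟨y, rfl⟩ := hx
    have h1 : f.base ((Proj.awayι ℬ (t j) (ht j) hd) y) =
      Proj.awayι 𝒜 (s j) (hs j) one_pos (Spec.map (CommRingCat.ofHom
        (awayHom φ d hφ (s j) (t j) (h j))) y) := by
      have := congr($(hf j) y)
      simpa using this
    rw [h1]
    have h2 := congr(Spec.map (CommRingCat.ofHom
        (awayHom φ d hφ (s j) (t j) (h j))) y ∈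
          $(Proj.awayι_preimage_basicOpen 𝒜 (hs j) one_pos (hs i) one_pos))
    have h3 := congr(y ∈ $(Proj.awayι_preimage_basicOpen ℬ (ht j) hd (ht i) hd))
    rw [← not_iff_not]
    change (_ ∈ Proj.awayι 𝒜 _ (hs j) one_pos ⁻¹ᵁ Proj.basicOpen 𝒜 (s i)) ↔
       (_ ∈ Proj.awayι ℬ _ (ht j) hd ⁻¹ᵁ Proj.basicOpen ℬ (t i))
    rw [h2, h3]
    have h4 : Away.isLocalizationElem (ht j) (ht i) =
      (awayHom φ d hφ (s j) (t j) (h j) (Away.isLocalizationElem (hs j) (hs i))) ^ d := by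
      ext
      rw [val_pow, val_awayHom, Away.val_mk, Away.val_mk, Localization.mk_eq_mk',
        Localization.mk_eq_mk', IsLocalization.map_mk', ← IsLocalization.mk'_pow]
      simp [h]
    rw [h4, PrimeSpectrum.basicOpen_pow _ _ hd]
    rfl
  · refine (cover t (fun _ ↦ d) ht (fun _ ↦ hd) hc).openCover.hom_ext _ _ fun i ↦ ?_
    change Proj.awayι ℬ (t i) (ht i) hd ≫ _ = Proj.awayι ℬ (t i) (ht i) hd ≫ _
    rw [reassoc_of% (hf i), Proj.awayι_toSpecZero, Proj.awayι_toSpecZero_assoc,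
      ← Spec.map_comp, ← Spec.map_comp, ← CommRingCat.ofHom_comp, ← CommRingCat.ofHom_comp]
    congr 2
    ext1 a
    exact awayHom_fromZero φ d hφ (h i) a (ψ a) (hψ a)

end
end P1Aux

namespace P1Aux

section

variable {k : Type*} [Field k]

theorem comp_mem (x : Proj (homogeneousSubmodule (Fin 2) k)) {f : MvPolynomial (Fin 2) k}
    (hf : f ∈ x.asHomogeneousIdeal.toIdeal) (i : ℕ) :
    homogeneousComponent i f ∈ x.asHomogeneousIdeal.toIdeal := by
  have := x.asHomogeneousIdeal.isHomogeneous i hf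
  rwa [← decomposition.decompose'_apply]

theorem le_ker (x : Proj (homogeneousSubmodule (Fin 2) k)) :
    x.asHomogeneousIdeal.toIdeal ≤ RingHom.ker (constantCoeff (σ := Fin 2) (R := k)) := by
  intro f hf
  have h0 := comp_mem x hf 0
  rw [homogeneousComponent_zero] at h0
  by_contra hne
  apply x.isPrime.ne_top
  refine Ideal.eq_top_of_isUnit_mem _ h0 ?_
  exact (IsUnit.mk0 _ hne).map C

theorem lt_ker (x : Proj (homogeneousSubmodule (Fin 2) k)) :
    x.asHomogeneousIdeal.toIdeal < RingHom.ker (constantCoeff (σ := Fin 2) (R := k)) := by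
  refine lt_of_le_of_ne (le_ker x) fun h ↦ x.not_irrelevant_le ?_
  intro f hf
  change f ∈ x.asHomogeneousIdeal.toIdeal
  rw [h, RingHom.mem_ker]
  have h1 := (HomogeneousIdeal.mem_irrelevant_iff _ _).mp hf
  rw [GradedRing.proj_apply] at h1
  have h2 : homogeneousComponent 0 f = 0 := by
    rw [← h1]; exact (decomposition.decompose'_apply f 0).symm
  rw [homogeneousComponent_zero] at h2
  simpa [constantCoeff_eq] using h2

theorem no_chain (I J M : Ideal (MvPolynomial (Fin 2) k)) [I.IsPrime] [J.IsPrime] [M.IsPrime]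
    (h0 : I ≠ ⊥) (h1 : I < J) (h2 : J < M) : False := by
  let s : LTSeries (PrimeSpectrum (MvPolynomial (Fin 2) k)) :=
    { length := 3
      toFun := ![⟨⊥, Ideal.isPrime_bot⟩, ⟨I, ‹_›⟩, ⟨J, ‹_›⟩, ⟨M, ‹_›⟩]
      step := by
        intro i
        fin_cases i
        · exact bot_lt_iff_ne_bot.mpr h0
        · exact h1
        · exact h2 }
  have h := Order.LTSeries.length_le_krullDim s
  have h3 : ringKrullDim (MvPolynomial (Fin 2) k) = 2 := by
    rw [MvPolynomial.ringKrullDim_of_isNoetherianRing]; simp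
  rw [ringKrullDim] at h3
  rw [h3] at h
  have : (3 : WithBot ℕ∞) ≤ 2 := h
  exact absurd this (by decide)

theorem exists_gen (x : Proj (homogeneousSubmodule (Fin 2) k))
    (hx : x.asHomogeneousIdeal.toIdeal ≠ ⊥) :
    ∃ (P : MvPolynomial (Fin 2) k) (d : ℕ), Prime P ∧ P.IsHomogeneous d ∧ 0 < d ∧
      x.asHomogeneousIdeal.toIdeal = Ideal.span {P} := by
  obtain ⟨P, hPx, hP⟩ := x.isPrime.exists_mem_prime_of_ne_bot hx
  have hPr : (Ideal.span {P}).IsPrime := (Ideal.span_singleton_prime hP.ne_zero).mpr hP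
  have heq : x.asHomogeneousIdeal.toIdeal = Ideal.span {P} := by
    by_contra hne
    have hle : Ideal.span {P} ≤ x.asHomogeneousIdeal.toIdeal :=
      (Ideal.span_singleton_le_iff_mem _).mpr hPx
    have := x.isPrime
    have := RingHom.ker_isPrime (constantCoeff (σ := Fin 2) (R := k))
    exact no_chain _ _ _ (by simpa using hP.ne_zero) (lt_of_le_of_ne hle (Ne.symm hne)) (lt_ker x)
  have hhom : P.IsHomogeneous P.totalDegree := by
    set d := P.totalDegree with hd
    have hc : homogeneousComponent d P ≠ 0 := by
      intro h
      obtain ⟨m, hm, hmd⟩ := Finset.exists_mem_eq_sup P.support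
        (support_nonempty.mpr hP.ne_zero) (fun m ↦ m.sum fun _ e ↦ e)
      have h4 := congrArg (coeff m) h
      rw [coeff_homogeneousComponent, if_pos, coeff_zero] at h4
      · exact (mem_support_iff.mp hm) h4
      · rw [hd, totalDegree, hmd]; rfl
    have hmem := comp_mem x hPx d
    rw [heq, Ideal.mem_span_singleton] at hmem
    obtain ⟨c, hcc⟩ := hmem
    have hc0 : c ≠ 0 := by rintro rfl; simp [hcc] at hc
    have hdeg := (homogeneousComponent_isHomogeneous d P).totalDegree hc
    rw [hcc, totalDegree_mul_of_isDomain hP.ne_zero hc0] at hdeg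
    have hcd : c.totalDegree = 0 := by omega
    rw [totalDegree_eq_zero_iff_eq_C] at hcd
    set a := coeff 0 c
    have ha : a ≠ 0 := by intro h; rw [hcd, h] at hc0; simp at hc0
    have hPe : P = homogeneousComponent d P * C a⁻¹ := by
      rw [hcc, hcd, mul_assoc, ← C_mul, mul_inv_cancel₀ ha, C_1, mul_one]
    rw [hPe]
    simpa using (homogeneousComponent_isHomogeneous d P).mul (isHomogeneous_C (Fin 2) a⁻¹)
  refine ⟨P, _, hP, hhom, ?_, heq⟩
  rw [Nat.pos_iff_ne_zero]
  intro h
  rw [totalDegree_eq_zero_iff_eq_C] at h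
  apply hP.not_isUnit
  rw [h]
  refine (IsUnit.mk0 _ ?_).map C
  intro h0
  rw [h0] at h
  exact hP.ne_zero (by simpa using h)

theorem eq_span_X (x : Proj (homogeneousSubmodule (Fin 2) k)) (i : Fin 2)
    (h : (X i : MvPolynomial (Fin 2) k) ∈ x.asHomogeneousIdeal) :
    x.asHomogeneousIdeal.toIdeal = Ideal.span {(X i : MvPolynomial (Fin 2) k)} := by
  obtain ⟨P, d, hP, -, -, heq⟩ := exists_gen x (fun hb ↦ by
    have h' : (X i : MvPolynomial (Fin 2) k) ∈ x.asHomogeneousIdeal.toIdeal := h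
    rw [hb] at h'
    exact X_ne_zero i h')
  rw [heq]
  have h' : (X i : MvPolynomial (Fin 2) k) ∈ x.asHomogeneousIdeal.toIdeal := h
  rw [heq, Ideal.mem_span_singleton] at h'
  exact Ideal.span_singleton_eq_span_singleton.mpr
    ((hP.dvd_prime_iff_associated (X_prime)).mp h')

theorem irrelevant_le (I : HomogeneousIdeal (homogeneousSubmodule (Fin 2) k))
    (h : ∀ i, (X i : MvPolynomial (Fin 2) k) ∈ I) :
    HomogeneousIdeal.irrelevant (homogeneousSubmodule (Fin 2) k) ≤ I := by
  intro f hf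
  have h1 := (HomogeneousIdeal.mem_irrelevant_iff _ _).mp hf
  rw [GradedRing.proj_apply] at h1
  have h2 : homogeneousComponent 0 f = 0 := by
    rw [← h1]; exact (decomposition.decompose'_apply f 0).symm
  rw [homogeneousComponent_zero] at h2
  have h3 : f ∈ Ideal.span (Set.range (X : Fin 2 → MvPolynomial (Fin 2) k)) := by
    rw [← Set.image_univ, mem_ideal_span_X_image]
    intro m hm
    by_contra! hne
    have : m = 0 := by ext i; exact hne i trivial
    rw [this, mem_support_iff] at hm
    exact hm (by simpa using h2)
  refine (Ideal.span_le (I := I.toIdeal)).mpr ?_ h3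
  rintro _ ⟨i, rfl⟩
  exact h i

theorem exists_X_notMem (x : Proj (homogeneousSubmodule (Fin 2) k)) :
    ∃ i, (X i : MvPolynomial (Fin 2) k) ∉ x.asHomogeneousIdeal := by
  by_contra! h
  exact x.not_irrelevant_le (irrelevant_le _ h)

/-- The generic point. -/
theorem exists_generic : ∃ x : Proj (homogeneousSubmodule (Fin 2) k),
    x.asHomogeneousIdeal.toIdeal = ⊥ := by
  refine ⟨⟨⊥, Ideal.isPrime_bot, fun h ↦ ?_⟩, rfl⟩
  have : (X 0 : MvPolynomial (Fin 2) k) ∈ (⊥ : Ideal (MvPolynomial (Fin 2) k)) := by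
    apply h
    rw [HomogeneousIdeal.mem_irrelevant_iff, GradedRing.proj_apply]
    exact DirectSum.decompose_of_mem_ne _ (isHomogeneous_X k (0 : Fin 2)) one_ne_zero
  exact X_ne_zero _ this

/-- The point `0`. -/
theorem exists_zero : ∃ x : Proj (homogeneousSubmodule (Fin 2) k),
    x.asHomogeneousIdeal.toIdeal = Ideal.span {(X 0 : MvPolynomial (Fin 2) k)} := by
  refine ⟨⟨⟨(Ideal.span {(X 0 : MvPolynomial (Fin 2) k)} : Ideal _), ?_⟩, ?_, fun h ↦ ?_⟩, rfl⟩
  · exact Ideal.homogeneous_span _ _ (by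
      rintro _ rfl
      exact ⟨1, isHomogeneous_X k (0 : Fin 2)⟩)
  · exact (Ideal.span_singleton_prime (X_ne_zero _)).mpr X_prime
  · have : (X 1 : MvPolynomial (Fin 2) k) ∈ Ideal.span {(X 0 : MvPolynomial (Fin 2) k)} := by
      apply h
      rw [HomogeneousIdeal.mem_irrelevant_iff, GradedRing.proj_apply]
      exact DirectSum.decompose_of_mem_ne _ (isHomogeneous_X k (1 : Fin 2)) one_ne_zero
    rw [Ideal.mem_span_singleton] at this
    rw [X_dvd_X] at this
    simp at this

theorem ne_bot_of_closed (x : Proj (homogeneousSubmodule (Fin 2) k))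
    (hx : IsClosed ({x} : Set (Proj (homogeneousSubmodule (Fin 2) k)))) :
    x.asHomogeneousIdeal.toIdeal ≠ ⊥ := by
  intro hb
  obtain ⟨z, hz⟩ := exists_zero (k := k)
  have h1 : z ∈ closure ({x} : Set (ProjectiveSpectrum (homogeneousSubmodule (Fin 2) k))) := by
    refine (ProjectiveSpectrum.le_iff_mem_closure _ x z).mp ?_
    change x.asHomogeneousIdeal.toIdeal ≤ _
    rw [hb]; exact bot_le
  have h2 : z ∈ ({x} : Set (Proj (homogeneousSubmodule (Fin 2) k))) := by
    rw [← hx.closure_eq]; exact h1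
  rw [h2, hb] at hz
  exact X_ne_zero (R := k) (0 : Fin 2) (Ideal.span_singleton_eq_bot.mp hz.symm)

end
end P1Aux

/-- Let `k` be a field and `q 0, q 1, …, q n` pairwise distinct closed points
of the projective line `ℙ¹_k = Proj k[W₀, W₁]`.  Then there is a non-constant morphism
`f : ℙ¹_k ⟶ ℙ¹_k` of `k`-schemes (i.e. commuting with the structure morphism
`Proj.toSpecZero`) with `f (q 0) = 0` and `f (q i) = ∞` for `1 ≤ i ≤ n`, where `0` and `∞`
are the `k`-rational points of `ℙ¹_k` whose homogeneous prime ideals are `(W₀)` and `(W₁)`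
respectively. -/
theorem exists_nonconstant_endomorphism_of_P1_with_prescribed_values
    (k : Type*) [Field k] (n : ℕ)
    (q : Fin (n + 1) → Proj (homogeneousSubmodule (Fin 2) k))
    (hclosed : ∀ i, IsClosed ({q i} : Set (Proj (homogeneousSubmodule (Fin 2) k))))
    (hdist : Function.Injective q) :
    ∃ f : Proj (homogeneousSubmodule (Fin 2) k) ⟶ Proj (homogeneousSubmodule (Fin 2) k),
      f ≫ Proj.toSpecZero (homogeneousSubmodule (Fin 2) k)
        = Proj.toSpecZero (homogeneousSubmodule (Fin 2) k) ∧
      ¬ (∃ y, ∀ x, f.base x = y) ∧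
      (f.base (q 0)).asHomogeneousIdeal.toIdeal
        = Ideal.span {(X 0 : MvPolynomial (Fin 2) k)} ∧
      ∀ i : Fin (n + 1), i ≠ 0 →
        (f.base (q i)).asHomogeneousIdeal.toIdeal
          = Ideal.span {(X 1 : MvPolynomial (Fin 2) k)} := by
    classical
  choose P d hP hPd hd hspan using fun i ↦ P1Aux.exists_gen (q i)
    (P1Aux.ne_bot_of_closed (q i) (hclosed i))
  obtain ⟨l, hl⟩ := P1Aux.exists_X_notMem (q 0)
  have hnd : ∀ i, i ≠ 0 → P i ∉ (q 0).asHomogeneousIdeal.toIdeal := by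
    intro i hi hmem
    rw [hspan 0, Ideal.mem_span_singleton] at hmem
    have hass := ((hP 0).dvd_prime_iff_associated (hP i)).mp hmem
    apply hi
    apply hdist
    apply ProjectiveSpectrum.ext
    apply HomogeneousIdeal.toIdeal_injective
    rw [hspan i, hspan 0]
    exact (Ideal.span_singleton_eq_span_singleton.mpr hass).symm
  let S : Finset (Fin (n + 1)) := Finset.univ.erase 0
  let G₀ : MvPolynomial (Fin 2) k := X l * ∏ i ∈ S, P i
  let e : ℕ := 1 + ∑ i ∈ S, d i
  have hG₀ : G₀.IsHomogeneous e :=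
    (isHomogeneous_X k l).mul (IsHomogeneous.prod S P d fun i _ ↦ hPd i)
  have hG₀q : G₀ ∉ (q 0).asHomogeneousIdeal.toIdeal := by
    intro h
    rcases (q 0).isPrime.mem_or_mem h with h | h
    · exact hl h
    · obtain ⟨i, hi, h⟩ := ((q 0).isPrime.prod_mem_iff).mp h
      exact hnd i (Finset.ne_of_mem_erase hi) h
  let F : MvPolynomial (Fin 2) k := P 0 ^ e
  let G : MvPolynomial (Fin 2) k := G₀ ^ d 0
  let D : ℕ := d 0 * e
  have he : 0 < e := by simp [e]
  have hD : 0 < D := Nat.mul_pos (hd 0) he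
  have hF : F.IsHomogeneous D := (hPd 0).pow e
  have hG : G.IsHomogeneous D := by
    have := hG₀.pow (d 0)
    rwa [mul_comm] at this
  have hFG : ∀ j, (![F, G] j).IsHomogeneous D := by
    intro j; fin_cases j
    · exact hF
    · exact hG
  have hFq : F ∈ (q 0).asHomogeneousIdeal.toIdeal := by
    refine Ideal.pow_mem_of_mem _ ?_ _ he
    rw [hspan 0]; exact Ideal.mem_span_singleton_self _
  have hGq : ∀ i, i ≠ 0 → G ∈ (q i).asHomogeneousIdeal.toIdeal := by
    intro i hi
    refine Ideal.pow_mem_of_mem _ (Ideal.mul_mem_left _ _ ?_) _ (hd 0)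
    refine ((q i).isPrime.prod_mem_iff).mpr ⟨i, Finset.mem_erase.mpr ⟨hi, Finset.mem_univ _⟩, ?_⟩
    rw [hspan i]; exact Ideal.mem_span_singleton_self _
  have hcover : ∀ x : Proj (homogeneousSubmodule (Fin 2) k),
      ∃ j, ![F, G] j ∉ x.asHomogeneousIdeal := by
    intro x
    by_contra! h
    have h0 : P 0 ∈ x.asHomogeneousIdeal.toIdeal := x.isPrime.mem_of_pow_mem _ (h 0)
    have h1 : G₀ ∈ x.asHomogeneousIdeal.toIdeal := x.isPrime.mem_of_pow_mem _ (h 1)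
    obtain ⟨Q, -, hQ, -, -, hQs⟩ := P1Aux.exists_gen x (fun hb ↦ by
      rw [hb] at h0; exact (hP 0).ne_zero h0)
    rw [hQs, Ideal.mem_span_singleton] at h0
    have hass := (hQ.dvd_prime_iff_associated (hP 0)).mp h0
    rw [hQs, Ideal.span_singleton_eq_span_singleton.mpr hass, ← hspan 0] at h1
    exact hG₀q h1
  let φ : MvPolynomial (Fin 2) k →ₐ[k] MvPolynomial (Fin 2) k := aeval ![F, G]
  obtain ⟨f, hf, hf0⟩ := P1Aux.exists_morphism (𝒜 := homogeneousSubmodule (Fin 2) k)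
    (ℬ := homogeneousSubmodule (Fin 2) k) φ.toRingHom D hD
    (fun i x hx ↦ IsHomogeneous.aeval hx _ hFG) X ![F, G] (fun i ↦ aeval_X _ i)
    (fun i ↦ isHomogeneous_X k i) hFG hcover
  have hq0 := P1Aux.eq_span_X (f.base (q 0)) 0 ((hf 0 (q 0)).mpr hFq)
  refine ⟨f, ?_, ?_, hq0, fun i hi ↦ P1Aux.eq_span_X _ 1 ((hf 1 (q i)).mpr (hGq i hi))⟩
  · rw [hf0 (RingHom.id _) ?_]
    · simp
    · intro a
      have ha : (a : MvPolynomial (Fin 2) k).totalDegree = 0 :=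
        Nat.le_zero.mp (IsHomogeneous.totalDegree_le a.2)
      rw [totalDegree_eq_zero_iff_eq_C] at ha
      change φ a = a
      rw [ha]
      exact algHom_C _ _
  · rintro ⟨y, hy⟩
    obtain ⟨z, hz⟩ := P1Aux.exists_generic (k := k)
    have h1 : (X 0 : MvPolynomial (Fin 2) k) ∈ (f.base z).asHomogeneousIdeal := by
      rw [hy z, ← hy (q 0)]
      exact (hf 0 (q 0)).mpr hFq
    have h2 : F ∈ z.asHomogeneousIdeal.toIdeal := (hf 0 z).mp h1
    rw [hz] at h2
    exact pow_ne_zero e (hP 0).ne_zero h2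
end
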